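/- Let F and C be independent real random variables on a common probability space, with F distributed as N(μ_f, σ_f²) and C distributed as N(μ_c, σ_c²), where σ_f > 0 and σ_c > 0, and let y⁺ ∈ ℝ. Then the expected constrained improvement has the closed form E[𝟙{C ≥ 0}·max(y⁺ − F, 0)] = Φ(μ_c/σ_c)·((y⁺ − μ_f)·Φ(z_f) + σ_f·φ(z_f)), where z_f = (y⁺ − μ_f)/σ_f. -/

import Mathlib

open MeasureTheory ProbabilityTheory Real

/-- The standard normal probability density function φ(s) = (2π)^{-1/2} exp(−s²/2). -/
noncomputable def stdNormalPDF (s : ℝ) : ℝ :=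
  (Real.sqrt (2 * Real.pi))⁻¹ * Real.exp (-(s ^ 2) / 2)

/-- The standard normal cumulative distribution function Φ(t) = ∫_{−∞}^{t} φ(s) ds. -/
noncomputable def stdNormalCDF (t : ℝ) : ℝ :=
  ∫ s in Set.Iic t, stdNormalPDF s

lemma stdNormalPDF_eq_gaussianPDFReal : stdNormalPDF = gaussianPDFReal 0 1 := by
  ext s
  simp [stdNormalPDF, gaussianPDFReal]

lemma integrable_stdNormalPDF : Integrable stdNormalPDF := by
  rw [stdNormalPDF_eq_gaussianPDFReal]
  exact integrable_gaussianPDFReal 0 1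

lemma hasDerivAt_stdNormalPDF (s : ℝ) : HasDerivAt stdNormalPDF (-s * stdNormalPDF s) s := by
  have h := ((((hasDerivAt_id s).pow 2).neg.div_const 2).exp).const_mul (√(2 * π))⁻¹
  convert! h using 1
  simp [stdNormalPDF]
  ring

lemma integrable_neg_mul_stdNormalPDF : Integrable fun s ↦ -s * stdNormalPDF s := by
  have h := (integrable_mul_exp_neg_mul_sq (b := 1 / 2) (by norm_num)).const_mul (-(√(2 * π))⁻¹)
  refine h.congr (ae_of_all _ fun s ↦ ?_)
  simp only [stdNormalPDF]
  rw [show -(1 / 2 : ℝ) * s ^ 2 = -(s ^ 2) / 2 by ring]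
  ring

lemma tendsto_stdNormalPDF_atBot : Filter.Tendsto stdNormalPDF Filter.atBot (nhds 0) := by
  have hsq : Filter.Tendsto (fun s : ℝ ↦ s ^ 2) Filter.atBot Filter.atTop := by
    simpa [Function.comp_def] using
      (Filter.tendsto_pow_atTop two_ne_zero).comp (Filter.tendsto_neg_atBot_atTop (G := ℝ))
  have h := (tendsto_exp_neg_atTop_nhds_zero.comp
    (hsq.atTop_div_const (show (0 : ℝ) < 2 by norm_num))).const_mul (√(2 * π))⁻¹
  rw [mul_zero] at h
  exact h.congr fun s ↦ by simp only [stdNormalPDF, Function.comp_def, neg_div]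

lemma integral_Iic_neg_mul_stdNormalPDF (z : ℝ) :
    ∫ s in Set.Iic z, -s * stdNormalPDF s = stdNormalPDF z := by
  simpa using integral_Iic_of_hasDerivAt_of_tendsto' (fun s _ ↦ hasDerivAt_stdNormalPDF s)
    integrable_neg_mul_stdNormalPDF.integrableOn tendsto_stdNormalPDF_atBot

lemma integral_stdNormalPDF_mul_max_sub (z : ℝ) :
    ∫ s, stdNormalPDF s * max (z - s) 0 = z * stdNormalCDF z + stdNormalPDF z := by
  have h : (fun s ↦ stdNormalPDF s * max (z - s) 0) =
      (Set.Iic z).indicator fun s ↦ z * stdNormalPDF s + -s * stdNormalPDF s := by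
    ext s
    by_cases hs : s ≤ z
    · rw [Set.indicator_of_mem (Set.mem_Iic.2 hs), max_eq_left (sub_nonneg.2 hs)]
      ring
    · rw [Set.indicator_of_notMem (by simpa using hs), max_eq_right (by linarith), mul_zero]
  rw [h, integral_indicator measurableSet_Iic,
    integral_add (integrable_stdNormalPDF.const_mul z).integrableOn
      integrable_neg_mul_stdNormalPDF.integrableOn,
    integral_const_mul, integral_Iic_neg_mul_stdNormalPDF, stdNormalCDF]

lemma gaussianReal_eq_map_standard (μ c : ℝ) (v : NNReal) (hv : (v : ℝ) = c ^ 2) :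
    gaussianReal μ v = (gaussianReal 0 1).map fun s ↦ μ + c * s := by
  have h : (fun s ↦ μ + c * s) = (μ + ·) ∘ (c * ·) := rfl
  rw [h, ← Measure.map_map (by fun_prop) (by fun_prop), gaussianReal_map_const_mul,
    gaussianReal_map_const_add]
  congr 1
  · simp
  · ext
    simp [hv]

lemma integral_gaussianReal_eq_integral_stdNormalPDF (μ c : ℝ) (v : NNReal)
    (hv : (v : ℝ) = c ^ 2) {f : ℝ → ℝ} (hf : Measurable f) :
    ∫ x, f x ∂gaussianReal μ v = ∫ s, stdNormalPDF s * f (μ + c * s) := by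
  rw [gaussianReal_eq_map_standard μ c v hv,
    integral_map (by fun_prop) hf.aestronglyMeasurable,
    integral_gaussianReal_eq_integral_smul one_ne_zero, stdNormalPDF_eq_gaussianPDFReal]
  rfl

lemma integral_max_sub_gaussianReal (μ σ y : ℝ) (hσ : 0 < σ) (v : NNReal)
    (hv : (v : ℝ) = σ ^ 2) :
    ∫ x, max (y - x) 0 ∂gaussianReal μ v =
      (y - μ) * stdNormalCDF ((y - μ) / σ) + σ * stdNormalPDF ((y - μ) / σ) := by
  rw [integral_gaussianReal_eq_integral_stdNormalPDF μ σ v hv (by fun_prop)]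
  have h (s : ℝ) : stdNormalPDF s * max (y - (μ + σ * s)) 0 =
      σ * (stdNormalPDF s * max ((y - μ) / σ - s) 0) := by
    have hs : y - (μ + σ * s) = σ * ((y - μ) / σ - s) := by
      field_simp
      ring
    have hmax := mul_max_of_nonneg ((y - μ) / σ - s) 0 hσ.le
    rw [mul_zero] at hmax
    rw [hs, ← hmax]
    ring
  simp_rw [h]
  rw [integral_const_mul, integral_stdNormalPDF_mul_max_sub]
  field_simp

lemma integral_ite_nonneg_gaussianReal (μ σ : ℝ) (hσ : 0 < σ) (v : NNReal)
    (hv : (v : ℝ) = σ ^ 2) :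
    ∫ x, (if 0 ≤ x then (1 : ℝ) else 0) ∂gaussianReal μ v = stdNormalCDF (μ / σ) := by
  rw [integral_gaussianReal_eq_integral_stdNormalPDF μ (-σ) v (by simpa using hv)
    (Measurable.ite measurableSet_Ici measurable_const measurable_const), stdNormalCDF,
    ← integral_indicator measurableSet_Iic]
  congr with s
  have h : 0 ≤ μ + -σ * s ↔ s ≤ μ / σ := by
    rw [le_div_iff₀ hσ]
    constructor <;> intro <;> linarith
  simp [Set.indicator_apply, -neg_mul, h]

/-- If F ~ N(μ_f, σ_f²) and C ~ N(μ_c, σ_c²) are independent with σ_f, σ_c > 0, then the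
expected constrained improvement at threshold y⁺ satisfies
E[𝟙{C ≥ 0}·max(y⁺ − F, 0)] = Φ(μ_c/σ_c)·((y⁺ − μ_f)·Φ(z_f) + σ_f·φ(z_f)),
with z_f = (y⁺ − μ_f)/σ_f. -/
theorem expected_constrained_improvement_gaussian {Ω : Type*} [MeasurableSpace Ω]
    (P : Measure Ω) [IsProbabilityMeasure P]
    (F C : Ω → ℝ) (hF : Measurable F) (hC : Measurable C)
    (hindep : IndepFun F C P)
    (μf σf μc σc : ℝ) (hσf : 0 < σf) (hσc : 0 < σc)
    (hFdist : P.map F = gaussianReal μf ⟨σf ^ 2, sq_nonneg σf⟩)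
    (hCdist : P.map C = gaussianReal μc ⟨σc ^ 2, sq_nonneg σc⟩)
    (yplus : ℝ) :
    (∫ ω, (if 0 ≤ C ω then (1 : ℝ) else 0) * max (yplus - F ω) 0 ∂P)
      = stdNormalCDF (μc / σc)
          * ((yplus - μf) * stdNormalCDF ((yplus - μf) / σf)
              + σf * stdNormalPDF ((yplus - μf) / σf)) := by
  have hite : Measurable fun c : ℝ ↦ if 0 ≤ c then (1 : ℝ) else 0 :=
    Measurable.ite measurableSet_Ici measurable_const measurable_const
  have hmax : Measurable fun x : ℝ ↦ max (yplus - x) 0 := by fun_prop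
  rw [hindep.symm.integral_fun_comp_mul_comp (f := fun c : ℝ ↦ if 0 ≤ c then (1 : ℝ) else 0)
      (g := fun x ↦ max (yplus - x) 0) hC.aemeasurable hF.aemeasurable
      hite.aestronglyMeasurable hmax.aestronglyMeasurable,
    ← integral_map hC.aemeasurable hite.aestronglyMeasurable,
    ← integral_map hF.aemeasurable hmax.aestronglyMeasurable, hCdist, hFdist]
  exact congrArg₂ (· * ·) (integral_ite_nonneg_gaussianReal μc σc hσc _ rfl)
    (integral_max_sub_gaussianReal μf σf yplus hσf _ rfl)
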